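/- Let R be an associative unital ring, let n ≥ 1 and let y₁,…,y_{2n} ∈ R. If both Euler continuants (y₁,y₂,…,y_{2n}) and (y_{2n},y_{2n−1},…,y₁) are invertible in R, then (y₁,…,y_{2n})^{−1}·(y₁,…,y_{2n−1}) = (y_{2n−1},y_{2n−2},…,y₁)·(y_{2n},y_{2n−1},…,y₁)^{−1}, where continuants of decreasing-index sequences are read in the order listed. -/

import Mathlib

/-- The Euler continuant `(y 1, …, y k)`, defined by the recursion
`( ) = 1`, `(x₁) = x₁`, `(x₁,…,x_k) = (x₁,…,x_{k−1})·x_k + (x₁,…,x_{k−2})`. -/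
def cont {R : Type*} [Ring R] (y : ℕ → R) : ℕ → R
  | 0 => 1
  | 1 => y 1
  | k + 2 => cont y (k + 1) * y (k + 2) + cont y k

theorem cont_left {R : Type*} [Ring R] (z : ℕ → R) (k : ℕ) :
    cont z (k + 2) = z 1 * cont (fun i => z (i + 1)) (k + 1) + cont (fun i => z (i + 2)) k := by
  induction k using Nat.strong_induction_on with
  | _ k ih =>
    match k, ih with
    | 0, _ => simp [cont]
    | 1, _ => simp [cont]; noncomm_ring
    | k + 2, ih =>
      have h1 := ih (k + 1) (by omega)
      have h0 := ih k (by omega)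
      rw [cont, show k + 2 + 1 = k + 1 + 2 from rfl, h1, h0]
      rw [cont.eq_3 (fun i => z (i + 1)) (k + 1), cont.eq_3 (fun i => z (i + 2)) k]
      simp only [mul_add, add_mul, mul_assoc]
      simp only [show k + 1 + 2 + 1 = k + 2 + 2 from rfl]
      abel

theorem cont_rev {R : Type*} [Ring R] (y : ℕ → R) (k : ℕ) :
    cont y k * cont (fun i => y (k + 2 - i)) (k + 1) =
      cont y (k + 1) * cont (fun i => y (k + 1 - i)) k := by
  induction k with
  | zero => simp [cont]
  | succ k ih =>
    have e1 : (fun i => y (k + 1 + 2 - (i + 1))) = fun i => y (k + 2 - i) := by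
      funext i; congr 1; omega
    have e2 : (fun i => y (k + 1 + 2 - (i + 2))) = fun i => y (k + 1 - i) := by
      funext i; congr 1; omega
    have e3 : k + 1 + 2 - 1 = k + 2 := by omega
    rw [show k + 1 + 1 = k + 2 from rfl, cont_left, e1, e2, e3, cont.eq_3 y k, mul_add, add_mul,
      ih, mul_assoc]

/-- If the Euler continuants `(y₁,…,y_{2n})` and `(y_{2n},…,y₁)` are (two-sided) invertible,
with inverses `u` and `v` respectively, then
`(y₁,…,y_{2n})⁻¹·(y₁,…,y_{2n−1}) = (y_{2n−1},…,y₁)·(y_{2n},…,y₁)⁻¹`. -/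
theorem continuant_inverse_identity {R : Type*} [Ring R] (n : ℕ) (hn : 1 ≤ n)
    (y : ℕ → R) (u v : R)
    (hu₁ : cont y (2 * n) * u = 1) (hu₂ : u * cont y (2 * n) = 1)
    (hv₁ : cont (fun i => y (2 * n + 1 - i)) (2 * n) * v = 1)
    (hv₂ : v * cont (fun i => y (2 * n + 1 - i)) (2 * n) = 1) :
    u * cont y (2 * n - 1) = cont (fun i => y (2 * n - i)) (2 * n - 1) * v := by
  obtain ⟨m, rfl⟩ : ∃ m, n = m + 1 := ⟨n - 1, by omega⟩
  have h := cont_rev y (2 * m + 1)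
  have e : 2 * (m + 1) = 2 * m + 2 := by ring
  rw [e] at hu₂ hv₁ ⊢
  have h' : cont y (2 * m + 1) * cont (fun i => y (2 * m + 2 + 1 - i)) (2 * m + 2) =
      cont y (2 * m + 2) * cont (fun i => y (2 * m + 2 - i)) (2 * m + 1) := h
  change u * cont y (2 * m + 1) = cont (fun i => y (2 * m + 2 - i)) (2 * m + 1) * v
  calc u * cont y (2 * m + 1)
      = u * (cont y (2 * m + 1) * cont (fun i => y (2 * m + 2 + 1 - i)) (2 * m + 2)) * v := by
        rw [mul_assoc, mul_assoc, hv₁, mul_one]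
    _ = _ := by rw [h', ← mul_assoc, hu₂, one_mul]
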